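/- Let (X,ρ,μ) be a quasi-metric measure space in which μ is Borel regular and Q-doubling for some Q ∈ (0,∞), and let Ω ⊂ X be a μ-measurable locally uniformly perfect set. Suppose there exist s ∈ (0,∞), p ∈ (0,Q/s), q ∈ (0,∞] with s ⪯_q ind(Ω,ρ), and a constant C_S > 0 such that for every ρ-ball B₀ = B_ρ(x₀,R₀) with x₀ ∈ Ω and R₀ ∈ (0,1], and every u ∈ Ṁ^s_{p,q}(Ω,ρ,μ): ‖u‖_{L^{p*}(B₀∩Ω)} ≤ (C_S / μ(B₀)^{s/Q}) [ R₀^s ‖u‖_{Ṁ^s_{p,q}(Ω,ρ,μ)} + ‖u‖_{L^p(Ω)} ], where p* := Qp/(Q−sp). Then Ω satisfies the measure density condition. -/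

import Mathlib

open MeasureTheory ENNReal Set

noncomputable section

namespace HajlaszPaper

variable {X : Type*}

/-- The `ρ`-ball centered at `x` with radius `r`. -/
def qball (ρ : X → X → ℝ) (x : X) (r : ℝ) : Set X := {y | ρ x y < r}

/-- `ρ` is a quasi-metric on `X`. -/
def IsQuasiDist (ρ : X → X → ℝ) : Prop :=
  (∀ x y, 0 ≤ ρ x y) ∧ (∀ x y, ρ x y = 0 ↔ x = y) ∧
    (∃ C₀ : ℝ, 1 ≤ C₀ ∧ ∀ x y, ρ y x ≤ C₀ * ρ x y) ∧
    (∃ C₁ : ℝ, 1 ≤ C₁ ∧ ∀ x y z, ρ x y ≤ C₁ * max (ρ x z) (ρ z y))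

/-- The least admissible quasi-triangle constant `C_ρ`. -/
def Crho (ρ : X → X → ℝ) : ℝ :=
  sInf {C : ℝ | 1 ≤ C ∧ ∀ x y z : X, ρ x y ≤ C * max (ρ x z) (ρ z y)}

/-- The least admissible quasi-symmetry constant `C̃_ρ`. -/
def CrhoTilde (ρ : X → X → ℝ) : ℝ :=
  sInf {C : ℝ | 1 ≤ C ∧ ∀ x y : X, ρ y x ≤ C * ρ x y}

/-- Two quasi-metrics are (bi-Lipschitz, i.e. pointwise) equivalent. -/
def EquivQM (ρ ϱ : X → X → ℝ) : Prop :=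
  ∃ c : ℝ, 1 ≤ c ∧ ∀ x y, c⁻¹ * ϱ x y ≤ ρ x y ∧ ρ x y ≤ c * ϱ x y

variable [MeasurableSpace X]

/-- `(X, ρ, μ)` is a quasi-metric measure space. -/
structure IsQMMS (ρ : X → X → ℝ) (μ : Measure X) : Prop where
  nontrivial : ∃ x y : X, x ≠ y
  quasi : IsQuasiDist ρ
  measurableSet_ball : ∀ (x : X) (r : ℝ), 0 < r → MeasurableSet (qball ρ x r)
  ball_pos : ∀ (x : X) (r : ℝ), 0 < r → 0 < μ (qball ρ x r)
  ball_lt_top : ∀ (x : X) (r : ℝ), 0 < r → μ (qball ρ x r) < ∞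

/-- Every `μ`-measurable set is contained in a Borel (measurable) set of equal measure. -/
def BorelRegular (μ : Measure X) : Prop :=
  ∀ A : Set X, ∃ B : Set X, A ⊆ B ∧ MeasurableSet B ∧ μ A = μ B

/-- `μ` is `Q`-doubling. -/
def QDoubling (ρ : X → X → ℝ) (μ : Measure X) (Q : ℝ) : Prop :=
  ∃ κ : ℝ, 0 < κ ∧ ∀ (x y : X) (r R : ℝ), 0 < r → r ≤ R →
    qball ρ x r ⊆ qball ρ y R →
    ENNReal.ofReal (κ * (r / R) ^ Q) * μ (qball ρ y R) ≤ μ (qball ρ x r)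

/-- `μ` is doubling. -/
def DoublingMeas (ρ : X → X → ℝ) (μ : Measure X) : Prop :=
  ∃ Cd : ℝ, 0 < Cd ∧ ∀ (x : X) (r : ℝ), 0 < r →
    μ (qball ρ x (2 * r)) ≤ ENNReal.ofReal Cd * μ (qball ρ x r)

/-- The measure density condition for `Ω`. -/
def MeasDensity (ρ : X → X → ℝ) (μ : Measure X) (Ω : Set X) : Prop :=
  ∃ c : ℝ, 0 < c ∧ ∀ x ∈ Ω, ∀ r : ℝ, 0 < r → r ≤ 1 →
    μ (qball ρ x r) ≤ ENNReal.ofReal c * μ (qball ρ x r ∩ Ω)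

/-- `Ω` is locally uniformly perfect with constant `lam ∈ (0,1)`. -/
def LocUnifPerfect (ρ : X → X → ℝ) (Ω : Set X) (lam : ℝ) : Prop :=
  ∀ x ∈ Ω, ∀ r : ℝ, 0 < r → r ≤ 1 → (Ω \ qball ρ x r).Nonempty →
    ((qball ρ x r ∩ Ω) \ qball ρ x (lam * r)).Nonempty

/-- The critical radius `φ^x_{Ω,ρ}(r)`. -/
def phiRad (ρ : X → X → ℝ) (μ : Measure X) (Ω : Set X) (x : X) (r : ℝ) : ℝ :=
  sSup {t : ℝ | 0 ≤ t ∧ t ≤ r ∧ μ (qball ρ x t ∩ Ω) ≤ μ (qball ρ x r ∩ Ω) / 2}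

/-- The collection `𝔻^s_ρ(u)` of fractional `s`-gradients of `u` on `Ω`. -/
def fracGrad (ρ : X → X → ℝ) (μ : Measure X) (Ω : Set X) (s : ℝ) (u : X → ℝ) :
    Set (ℤ → X → ℝ) :=
  {g | (∀ k x, 0 ≤ g k x) ∧ (∀ k, AEMeasurable (g k) (μ.restrict Ω)) ∧
    ∃ E : Set X, μ E = 0 ∧ ∀ k : ℤ, ∀ x ∈ Ω \ E, ∀ y ∈ Ω \ E,
      (2 : ℝ) ^ (-k - 1) ≤ ρ x y → ρ x y < (2 : ℝ) ^ (-k) →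
      |u x - u y| ≤ ρ x y ^ s * (g k x + g k y)}

/-- `g` is an `s`-gradient of `u` on `S`. -/
def IsSGradOn (ρ : X → X → ℝ) (μ : Measure X) (S : Set X) (s : ℝ) (u g : X → ℝ) : Prop :=
  (∀ x, 0 ≤ g x) ∧ AEMeasurable g (μ.restrict S) ∧
    ∃ E : Set X, μ E = 0 ∧ ∀ x ∈ S \ E, ∀ y ∈ S \ E,
      |u x - u y| ≤ ρ x y ^ s * (g x + g y)

/-- The `ℓ^q` norm (`0 < q ≤ ∞`) of a `ℤ`-indexed sequence in `[0,∞]`. -/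
def lqN (q : ℝ≥0∞) (a : ℤ → ℝ≥0∞) : ℝ≥0∞ :=
  if q = ∞ then ⨆ k, a k else (∑' k, a k ^ q.toReal) ^ (1 / q.toReal)

/-- The `L^p` "norm" (`0 < p < ∞`) of a `[0,∞]`-valued function. -/
def lpN (μ : Measure X) (p : ℝ) (f : X → ℝ≥0∞) : ℝ≥0∞ :=
  (∫⁻ x, f x ^ p ∂μ) ^ (1 / p)

/-- The `L^p` norm of `u : X → ℝ` over the set `Ω`. -/
def lpOn (μ : Measure X) (Ω : Set X) (p : ℝ) (u : X → ℝ) : ℝ≥0∞ :=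
  lpN (μ.restrict Ω) p fun x => ENNReal.ofReal |u x|

/-- The homogeneous Hajłasz–Triebel–Lizorkin quasi-norm `‖u‖_{Ṁ^s_{p,q}(Ω,ρ,μ)}`. -/
def MdotNorm (ρ : X → X → ℝ) (μ : Measure X) (Ω : Set X) (s p : ℝ) (q : ℝ≥0∞)
    (u : X → ℝ) : ℝ≥0∞ :=
  ⨅ g ∈ fracGrad ρ μ Ω s u,
    lpN (μ.restrict Ω) p fun x => lqN q fun k => ENNReal.ofReal (g k x)

/-- The homogeneous Hajłasz–Besov quasi-norm `‖u‖_{Ṅ^s_{p,q}(Ω,ρ,μ)}`. -/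
def NdotNorm (ρ : X → X → ℝ) (μ : Measure X) (Ω : Set X) (s p : ℝ) (q : ℝ≥0∞)
    (u : X → ℝ) : ℝ≥0∞ :=
  ⨅ g ∈ fracGrad ρ μ Ω s u,
    lqN q fun k => lpN (μ.restrict Ω) p fun x => ENNReal.ofReal (g k x)

/-- Membership in `M^s_{p,q}(Ω,ρ,μ)`. -/
def MemMspq (ρ : X → X → ℝ) (μ : Measure X) (Ω : Set X) (s p : ℝ) (q : ℝ≥0∞)
    (u : X → ℝ) : Prop :=
  AEMeasurable u (μ.restrict Ω) ∧ lpOn μ Ω p u ≠ ∞ ∧ MdotNorm ρ μ Ω s p q u ≠ ∞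

/-- Membership in `N^s_{p,q}(Ω,ρ,μ)`. -/
def MemNspq (ρ : X → X → ℝ) (μ : Measure X) (Ω : Set X) (s p : ℝ) (q : ℝ≥0∞)
    (u : X → ℝ) : Prop :=
  AEMeasurable u (μ.restrict Ω) ∧ lpOn μ Ω p u ≠ ∞ ∧ NdotNorm ρ μ Ω s p q u ≠ ∞

/-- The quasi-norm of `M^s_{p,q}(Ω,ρ,μ)`. -/
def MNorm (ρ : X → X → ℝ) (μ : Measure X) (Ω : Set X) (s p : ℝ) (q : ℝ≥0∞)
    (u : X → ℝ) : ℝ≥0∞ :=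
  MdotNorm ρ μ Ω s p q u + lpOn μ Ω p u

/-- The quasi-norm of `N^s_{p,q}(Ω,ρ,μ)`. -/
def NNorm (ρ : X → X → ℝ) (μ : Measure X) (Ω : Set X) (s p : ℝ) (q : ℝ≥0∞)
    (u : X → ℝ) : ℝ≥0∞ :=
  NdotNorm ρ μ Ω s p q u + lpOn μ Ω p u

/-- `s ⪯_q ind(X,ρ)` : there is a quasi-metric `ϱ ≈ ρ` with `s ≤ (log₂ C_ϱ)⁻¹`
(equivalently `C_ϱ ^ s ≤ 2`), where equality is permitted only when `q = ∞`. -/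
def SPrecIndex (ρ : X → X → ℝ) (s : ℝ) (q : ℝ≥0∞) : Prop :=
  ∃ ϱ : X → X → ℝ, IsQuasiDist ϱ ∧ EquivQM ρ ϱ ∧
    (Crho ϱ ^ s < 2 ∨ (q = ∞ ∧ Crho ϱ ^ s ≤ 2))

/-- `s < ind(X,ρ)` : there is a quasi-metric `ϱ ≈ ρ` with `s < (log₂ C_ϱ)⁻¹`
(equivalently `C_ϱ ^ s < 2`). -/
def SLtIndex (ρ : X → X → ℝ) (s : ℝ) : Prop :=
  ∃ ϱ : X → X → ℝ, IsQuasiDist ϱ ∧ EquivQM ρ ϱ ∧ Crho ϱ ^ s < 2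

/-- The median value `m_u(E)`. -/
def medianVal (μ : Measure X) (E : Set X) (u : X → ℝ) : ℝ :=
  sSup {θ : ℝ | μ {x ∈ E | u x < θ} ≤ μ E / 2}

/-- `f` belongs to the homogeneous Hölder space `Ċ^α(X,ρ)`. -/
def MemHolder (ρ : X → X → ℝ) (α : ℝ) (f : X → ℝ) : Prop :=
  ∃ H : ℝ, 0 ≤ H ∧ ∀ x y : X, |f x - f y| ≤ H * ρ x y ^ α

/-- The Hölder seminorm `‖f‖_{Ċ^α(X,ρ)}`. -/
def holderNorm (ρ : X → X → ℝ) (α : ℝ) (f : X → ℝ) : ℝ :=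
  sInf {H : ℝ | 0 ≤ H ∧ ∀ x y : X, |f x - f y| ≤ H * ρ x y ^ α}

/-- The sup norm of `f`. -/
def supNorm (f : X → ℝ) : ℝ := sSup (Set.range fun x => |f x|)

/-- `ρ` is a genuine metric. -/
def IsMetricDist (ρ : X → X → ℝ) : Prop :=
  (∀ x y, 0 ≤ ρ x y) ∧ (∀ x y, ρ x y = 0 ↔ x = y) ∧ (∀ x y, ρ x y = ρ y x) ∧
    (∀ x y z, ρ x y ≤ ρ x z + ρ z y)

/-- The homogeneous Hajłasz–Sobolev quasi-norm `‖u‖_{Ṁ^{1,p}(Ω,ρ,μ)}`. -/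
def M1pDotNorm (ρ : X → X → ℝ) (μ : Measure X) (Ω : Set X) (p : ℝ) (u : X → ℝ) : ℝ≥0∞ :=
  ⨅ g ∈ {g : X → ℝ | IsSGradOn ρ μ Ω 1 u g},
    lpN (μ.restrict Ω) p fun x => ENNReal.ofReal (g x)

/-- Membership in the Hajłasz–Sobolev space `M^{1,p}(Ω,ρ,μ)`. -/
def MemM1p (ρ : X → X → ℝ) (μ : Measure X) (Ω : Set X) (p : ℝ) (u : X → ℝ) : Prop :=
  AEMeasurable u (μ.restrict Ω) ∧ lpOn μ Ω p u ≠ ∞ ∧ M1pDotNorm ρ μ Ω p u ≠ ∞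

/-- The quasi-norm of `M^{1,p}(Ω,ρ,μ)`. -/
def M1pNorm (ρ : X → X → ℝ) (μ : Measure X) (Ω : Set X) (p : ℝ) (u : X → ℝ) : ℝ≥0∞ :=
  lpOn μ Ω p u + M1pDotNorm ρ μ Ω p u

/-- **Frink's chain inequality**: if `e` is a symmetric function satisfying the quasi-triangle
inequality with constant `2`, then a chain of length at least two dominates `e` with
weight `2` on the end edges and `4` on the inner ones. -/
theorem frink_chain {Y : Type*} {e : Y → Y → ℝ} (e_nonneg : ∀ y z, 0 ≤ e y z)
    (e_tri : ∀ x y z, e x y ≤ 2 * max (e x z) (e z y)) (n : ℕ) (hn : 2 ≤ n) (f : ℕ → Y) :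
    e (f 0) (f n) ≤ 4 * ∑ i ∈ Finset.range n, e (f i) (f (i + 1)) -
      2 * e (f 0) (f 1) - 2 * e (f (n - 1)) (f n) := by
  induction n using Nat.strong_induction_on generalizing f with
  | _ n ih =>
  have hterm : ∀ i, 0 ≤ e (f i) (f (i + 1)) := fun i => e_nonneg _ _
  obtain ⟨m, rfl⟩ : ∃ m, n = m + 2 := ⟨n - 2, by omega⟩
  have hsplit : e (f 0) (f 1) + e (f (m + 1)) (f (m + 2)) ≤
      ∑ i ∈ Finset.range (m + 2), e (f i) (f (i + 1)) := by
    rw [Finset.sum_range_succ, Finset.sum_range_succ']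
    have := Finset.sum_nonneg (s := Finset.range m) fun i _ => hterm (i + 1)
    simp only [zero_add]
    linarith
  simp only [Nat.add_succ_sub_one] at *
  have hlast := hterm (m + 1)
  have hfirst := hterm 0
  simp only [zero_add, add_assoc, Nat.reduceAdd] at hlast hfirst
  by_cases hsmall : e (f 0) (f (m + 2)) ≤ 2 * e (f (m + 1)) (f (m + 2))
  · linarith
  have hex : ∃ k, ¬ e (f 0) (f (m + 2)) ≤ 2 * e (f k) (f (m + 2)) := ⟨m + 1, hsmall⟩
  classical
  obtain ⟨hk, hmin⟩ := And.intro (Nat.find_spec hex) fun j => Nat.find_min (m := j) hex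
  have hkm : Nat.find hex ≤ m + 1 := Nat.find_min' hex hsmall
  generalize Nat.find hex = k at hk hmin hkm
  obtain ⟨j, rfl⟩ : ∃ j, k = j + 1 := by
    refine Nat.exists_eq_succ_of_ne_zero ?_
    rintro rfl
    exact hk (by linarith [e_nonneg (f 0) (f (m + 2))])
  have hj : e (f 0) (f (m + 2)) ≤ 2 * e (f j) (f (m + 2)) := not_not.1 (hmin j (by omega))
  have hj' : e (f 0) (f (m + 2)) ≤ 2 * e (f 0) (f (j + 1)) := by
    rcases max_cases (e (f 0) (f (j + 1))) (e (f (j + 1)) (f (m + 2))) with h | h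
    · simpa [h.1] using e_tri (f 0) (f (m + 2)) (f (j + 1))
    · exact absurd (by simpa [h.1] using e_tri (f 0) (f (m + 2)) (f (j + 1))) hk
  rcases Nat.eq_zero_or_pos j with rfl | hjpos
  · simp only [zero_add] at hj'
    linarith
  have h₁ := ih (j + 1) (by omega) (by omega) f
  have h₂ := ih (m + 2 - j) (by omega) (by omega) fun i => f (j + i)
  have hsum : ∑ i ∈ Finset.range (m + 2), e (f i) (f (i + 1)) =
      ∑ i ∈ Finset.range j, e (f i) (f (i + 1)) +
        ∑ i ∈ Finset.range (m + 2 - j), e (f (j + i)) (f (j + (i + 1))) := by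
    conv_lhs => rw [show m + 2 = j + (m + 2 - j) by omega]
    rw [Finset.sum_range_add]
    rfl
  rw [Finset.sum_range_succ] at h₁
  simp only [add_zero, Nat.add_sub_cancel, show j + (m + 2 - j) = m + 2 by omega,
    show j + (m + 2 - j - 1) = m + 1 by omega] at h₁ h₂
  linarith

theorem exists_chain_of_list {Y M : Type*} [AddCommMonoid M] (e : Y → Y → M) (l : List Y)
    (x y : Y) :
    ∃ (n : ℕ) (f : ℕ → Y), f 0 = x ∧ f (n + 1) = y ∧
      ∑ i ∈ Finset.range (n + 1), e (f i) (f (i + 1)) =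
        (List.zipWith e (x :: l) (l ++ [y])).sum := by
  induction l generalizing x with
  | nil => exact ⟨0, fun i => if i = 0 then x else y, by simp⟩
  | cons a l ih =>
    obtain ⟨n, f, h0, hn, hsum⟩ := ih a
    refine ⟨n + 1, fun i => Nat.casesOn i x f, rfl, hn, ?_⟩
    rw [Finset.sum_range_succ', List.cons_append, List.zipWith_cons_cons, List.sum_cons, ← hsum,
      add_comm]
    simp only [h0]
    rfl

/-- A symmetric function vanishing on the diagonal and satisfying the quasi-triangle inequality
with constant `2` is comparable to a pseudometric. -/
theorem exists_pseudoMetric_of_two {Y : Type*} (e : Y → Y → ℝ) (e_nonneg : ∀ y z, 0 ≤ e y z)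
    (e_self : ∀ y, e y y = 0) (e_comm : ∀ y z, e y z = e z y)
    (e_tri : ∀ x y z, e x y ≤ 2 * max (e x z) (e z y)) :
    ∃ _ : PseudoMetricSpace Y, ∀ y z : Y, dist y z ≤ e y z ∧ e y z ≤ 4 * dist y z := by
  let d : Y → Y → NNReal := fun y z => ⟨e y z, e_nonneg y z⟩
  have d_self : ∀ y, d y y = 0 := fun y => NNReal.eq (e_self y)
  have d_comm : ∀ y z, d y z = d z y := fun y z => NNReal.eq (e_comm y z)
  refine ⟨PseudoMetricSpace.ofPreNNDist d d_self d_comm, fun y z =>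
    ⟨PseudoMetricSpace.dist_ofPreNNDist_le d d_self d_comm y z, ?_⟩⟩
  rw [PseudoMetricSpace.dist_ofPreNNDist]
  suffices h : d y z ≤ 4 * ⨅ l : List Y, ((y :: l).zipWith d (l ++ [z])).sum from
    NNReal.coe_le_coe.2 h
  rw [NNReal.mul_iInf]
  refine le_ciInf fun l => ?_
  obtain ⟨n, f, rfl, rfl, hsum⟩ := exists_chain_of_list d l y z
  rw [← hsum, ← NNReal.coe_le_coe]
  push_cast
  change e _ _ ≤ 4 * ∑ i ∈ Finset.range (n + 1), e (f i) (f (i + 1))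
  rcases n with _ | n
  · simp only [zero_add, Finset.range_one, Finset.sum_singleton]
    linarith [e_nonneg (f 0) (f 1)]
  · linarith [frink_chain e_nonneg e_tri (n + 2) (by omega) f, e_nonneg (f 0) (f 1),
      e_nonneg (f (n + 2 - 1)) (f (n + 2))]

theorem le_Crho_mul_max {Y : Type*} {ϱ : Y → Y → ℝ} (hϱ : IsQuasiDist ϱ) (x y z : Y) :
    ϱ x y ≤ Crho ϱ * max (ϱ x z) (ϱ z y) := by
  obtain ⟨h_nonneg, -, -, C₁, hC₁, h_tri⟩ := hϱ
  rcases (le_max_of_le_left (h_nonneg x z) : 0 ≤ max (ϱ x z) (ϱ z y)).eq_or_lt with h | h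
  · simpa [← h] using h_tri x y z
  · rw [← div_le_iff₀ h]
    exact le_csInf ⟨C₁, hC₁, h_tri⟩ fun C hC => (div_le_iff₀ h).2 (hC.2 x y z)

theorem one_le_Crho {Y : Type*} {ϱ : Y → Y → ℝ} (hϱ : IsQuasiDist ϱ) : 1 ≤ Crho ϱ := by
  obtain ⟨-, -, -, C₁, hC₁, h_tri⟩ := hϱ
  exact le_csInf ⟨C₁, hC₁, h_tri⟩ fun C hC => hC.1

/-- Sharp metrization: if `Crho ϱ ^ α ≤ 2`, then the `α`-th power of any function equivalent
to `ϱ` is comparable to a pseudometric. -/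
theorem exists_pseudoMetric_of_Crho_rpow_le {Y : Type*} {ρ ϱ : Y → Y → ℝ} (hϱ : IsQuasiDist ϱ)
    (heq : EquivQM ρ ϱ) {α : ℝ} (hα : 0 < α) (hC : Crho ϱ ^ α ≤ 2) :
    ∃ _ : PseudoMetricSpace Y, ∃ A : ℝ, 1 ≤ A ∧
      ∀ y z : Y, dist y z ≤ A * ρ y z ^ α ∧ ρ y z ^ α ≤ A * dist y z := by
  have h_tri := le_Crho_mul_max hϱ
  have hC1 := one_le_Crho hϱ
  obtain ⟨h_nonneg, h_zero, ⟨C₀, hC₀, h_symm⟩, -⟩ := hϱ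
  obtain ⟨c, hc, hcomp⟩ := heq
  have hρ_nonneg : ∀ y z, 0 ≤ ρ y z := fun y z =>
    (mul_nonneg (by positivity) (h_nonneg y z)).trans (hcomp y z).1
  have hm_nonneg : ∀ y z, 0 ≤ max (ϱ y z) (ϱ z y) := fun y z => le_max_of_le_left (h_nonneg y z)
  obtain ⟨m, hm⟩ := exists_pseudoMetric_of_two (fun y z => max (ϱ y z) (ϱ z y) ^ α)
    (fun y z => Real.rpow_nonneg (hm_nonneg y z) α)
    (fun y => by simp [(h_zero y y).2 rfl, Real.zero_rpow hα.ne'])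
    (fun y z => by rw [max_comm]) (fun x y z => by
      have key : max (ϱ x y) (ϱ y x) ≤
          Crho ϱ * max (max (ϱ x z) (ϱ z x)) (max (ϱ z y) (ϱ y z)) := by
        refine max_le ((h_tri x y z).trans ?_) ((h_tri y x z).trans ?_) <;>
        refine mul_le_mul_of_nonneg_left (max_le ?_ ?_) (by linarith) <;> simp
      calc max (ϱ x y) (ϱ y x) ^ α
          ≤ (Crho ϱ * max (max (ϱ x z) (ϱ z x)) (max (ϱ z y) (ϱ y z))) ^ α :=
            Real.rpow_le_rpow (hm_nonneg x y) key hα.le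
        _ = Crho ϱ ^ α * max (max (ϱ x z) (ϱ z x) ^ α) (max (ϱ z y) (ϱ y z) ^ α) := by
            rw [Real.mul_rpow (by linarith) (le_max_of_le_left (hm_nonneg x z)),
              (Real.monotoneOn_rpow_Ici_of_exponent_nonneg hα.le).map_max
                (hm_nonneg x z) (hm_nonneg z y)]
        _ ≤ _ := mul_le_mul_of_nonneg_right hC
            (le_max_of_le_left (Real.rpow_nonneg (hm_nonneg x z) α)))
  have hcα : (1 : ℝ) ≤ c ^ α := Real.one_le_rpow hc hα.le
  have hC₀α : (1 : ℝ) ≤ C₀ ^ α := Real.one_le_rpow hC₀ hα.le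
  refine ⟨m, 4 * (C₀ ^ α * c ^ α), by nlinarith, fun y z => ⟨?_, ?_⟩⟩
  · have h1 : max (ϱ y z) (ϱ z y) ≤ C₀ * c * ρ y z := by
      have h2 : ϱ y z ≤ c * ρ y z := (inv_mul_le_iff₀ (by linarith)).1 (hcomp y z).1
      have h3 : C₀ * ϱ y z ≤ C₀ * (c * ρ y z) := mul_le_mul_of_nonneg_left h2 (by linarith)
      refine max_le ?_ ?_ <;> nlinarith [h_symm y z, h_nonneg y z]
    calc dist y z ≤ max (ϱ y z) (ϱ z y) ^ α := (hm y z).1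
      _ ≤ (C₀ * c * ρ y z) ^ α := Real.rpow_le_rpow (hm_nonneg y z) h1 hα.le
      _ = C₀ ^ α * c ^ α * ρ y z ^ α := by
        rw [Real.mul_rpow (by positivity) (hρ_nonneg y z),
          Real.mul_rpow (by positivity) (by positivity)]
      _ ≤ _ := by
        refine mul_le_mul_of_nonneg_right ?_ (Real.rpow_nonneg (hρ_nonneg y z) α)
        nlinarith
  · calc ρ y z ^ α ≤ (c * max (ϱ y z) (ϱ z y)) ^ α :=
          Real.rpow_le_rpow (hρ_nonneg y z) ((hcomp y z).2.trans
            (mul_le_mul_of_nonneg_left (le_max_left _ _) (by linarith))) hα.le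
      _ = c ^ α * max (ϱ y z) (ϱ z y) ^ α := Real.mul_rpow (by linarith) (hm_nonneg y z)
      _ ≤ c ^ α * (4 * dist y z) := mul_le_mul_of_nonneg_left (hm y z).2 (by linarith)
      _ ≤ _ := by
        have h4 : 0 ≤ c ^ α * dist y z := by positivity
        nlinarith

/-- If `s ⪯_q ind(Y, ρ)`, then some power `ρ ^ α` with `s < α` (or `s = α` if `q = ∞`) is
comparable to a pseudometric. -/
theorem SPrecIndex.exists_pseudoMetric {Y : Type*} {ρ : Y → Y → ℝ} {s : ℝ} {q : ℝ≥0∞}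
    (hs : 0 < s) (h : SPrecIndex ρ s q) :
    ∃ α : ℝ, s ≤ α ∧ (q ≠ ∞ → s < α) ∧ ∃ _ : PseudoMetricSpace Y, ∃ A : ℝ, 1 ≤ A ∧
      ∀ y z : Y, dist y z ≤ A * ρ y z ^ α ∧ ρ y z ^ α ≤ A * dist y z := by
  obtain ⟨ϱ, hϱ, heq, hlt | ⟨rfl, hle⟩⟩ := h
  · have hC := one_le_Crho hϱ
    have hcont : ContinuousAt (fun t : ℝ => Crho ϱ ^ t) s :=
      Real.continuousAt_const_rpow (by linarith)
    obtain ⟨α, hα, hsα⟩ := ((hcont.eventually_lt_const hlt).filter_mono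
      nhdsWithin_le_nhds |>.and self_mem_nhdsWithin : ∀ᶠ t in nhdsWithin s (Ioi s), _).exists
    exact ⟨α, le_of_lt hsα, fun _ => hsα,
      exists_pseudoMetric_of_Crho_rpow_le hϱ heq (hs.trans hsα) hα.le⟩
  · exact ⟨s, le_rfl, fun h => absurd rfl h, exists_pseudoMetric_of_Crho_rpow_le hϱ heq hs hle⟩

theorem IsQMMS.sigmaFinite {ρ : X → X → ℝ} {μ : Measure X} (hX : IsQMMS ρ μ) : SigmaFinite μ := by
  obtain ⟨x₀, -, -⟩ := hX.nontrivial
  refine ⟨⟨⟨fun n : ℕ => qball ρ x₀ (n + 1), fun _ => trivial,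
    fun n => hX.ball_lt_top x₀ _ (by positivity), ?_⟩⟩⟩
  refine iUnion_eq_univ_iff.2 fun y => ?_
  obtain ⟨n, hn⟩ := exists_nat_gt (ρ x₀ y)
  exact ⟨n, hn.trans (by linarith)⟩

theorem exists_rpow_radius {A α ε : ℝ} (hA : 1 ≤ A) (hα : 0 < α) (hε : 0 < ε) :
    ∃ r : ℝ, 0 < r ∧ r ≤ 1 ∧ A * r ^ α ≤ ε := by
  have hA0 : 0 < A := by linarith
  refine ⟨min 1 ((ε / A) ^ α⁻¹), by positivity, min_le_left _ _, ?_⟩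
  calc A * (min 1 ((ε / A) ^ α⁻¹)) ^ α ≤ A * ((ε / A) ^ α⁻¹) ^ α := by
        gcongr
        exact min_le_right _ _
    _ = ε := by rw [Real.rpow_inv_rpow (by positivity) hα.ne']; field_simp

section Measurability

variable {ρ : X → X → ℝ} {μ : Measure X} {Ω : Set X} [PseudoMetricSpace Ω] {A α : ℝ}

theorem secondCountable_of_dist_le (hX : IsQMMS ρ μ) (hΩ : MeasurableSet Ω)
    (hΩpos : ∀ x ∈ Ω, ∀ r : ℝ, 0 < r → r ≤ 1 → 0 < μ (qball ρ x r ∩ Ω))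
    (hA : 1 ≤ A) (hα : 0 < α) (hle : ∀ y z : Ω, dist y z ≤ A * ρ y z ^ α) :
    SecondCountableTopology Ω := by
  have := hX.sigmaFinite
  refine Metric.secondCountable_of_almost_dense_set fun ε hε => ?_
  obtain ⟨r, hr0, hr1, hr⟩ := exists_rpow_radius hA hα (half_pos hε)
  obtain ⟨N, hN⟩ : ∃ N, Maximal (fun N : Set Ω => N.Pairwise fun y z => ε < dist y z) N := by
    refine zorn_subset _ fun c hc hchain => ⟨⋃₀ c, ?_, fun _ => subset_sUnion_of_mem⟩
    exact (pairwise_sUnion hchain.directedOn).2 hc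
  refine ⟨N, ?_, fun x => ?_⟩
  · have hnear : ∀ y : Ω, ∀ w : Ω, (w : X) ∈ qball ρ y r → dist y w ≤ ε / 2 := fun y w hw =>
      (hle y w).trans ((mul_le_mul_of_nonneg_left
        (Real.rpow_le_rpow (hX.quasi.1 _ _) (le_of_lt hw) hα.le) (by linarith)).trans hr)
    have hcount := Measure.countable_meas_pos_of_disjoint_iUnion (μ := μ)
      (As := fun y : N => qball ρ (y : Ω) r ∩ Ω)
      (fun y => (hX.measurableSet_ball _ r hr0).inter hΩ) (by
        refine fun y z hyz => Set.disjoint_left.2 fun w hwy hwz => ?_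
        have h1 := hnear y ⟨w, hwy.2⟩ hwy.1
        have h2 := hnear z ⟨w, hwz.2⟩ hwz.1
        have h3 := hN.prop y.2 z.2 (Subtype.coe_injective.ne hyz)
        have h4 := dist_triangle_right (y : Ω) z ⟨w, hwy.2⟩
        linarith)
    rw [← Set.countable_coe_iff, ← Set.countable_univ_iff]
    exact hcount.mono fun y _ => hΩpos _ (y : Ω).2 r hr0 hr1
  · by_contra! hx
    have hxN : x ∉ N := fun h => by simpa using (hx x h).trans' hε
    refine hxN (hN.mem_of_prop_insert ?_)
    refine hN.prop.insert fun y hy _ => ⟨hx y hy, ?_⟩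
    rw [dist_comm]
    exact hx y hy

theorem opensMeasurable_of_dist_comparable (hX : IsQMMS ρ μ) (hΩ : MeasurableSet Ω)
    (hΩpos : ∀ x ∈ Ω, ∀ r : ℝ, 0 < r → r ≤ 1 → 0 < μ (qball ρ x r ∩ Ω))
    (hA : 1 ≤ A) (hα : 0 < α)
    (hcomp : ∀ y z : Ω, dist y z ≤ A * ρ y z ^ α ∧ ρ y z ^ α ≤ A * dist y z) :
    OpensMeasurableSpace Ω := by
  have := secondCountable_of_dist_le hX hΩ hΩpos hA hα fun y z => (hcomp y z).1
  refine ⟨MeasurableSpace.generateFrom_le fun U (hU : IsOpen U) => ?_⟩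
  have hball : ∀ y : Ω, ∀ r : ℝ, 0 < r → MeasurableSet {w : Ω | ρ y w < r} := fun y r hr =>
    measurable_subtype_coe (hX.measurableSet_ball y r hr)
  have hex : ∀ y : U, ∃ r : ℝ, 0 < r ∧ {w : Ω | ρ (y : Ω) w < r} ⊆ U := by
    intro y
    obtain ⟨ε, hε, hεU⟩ := Metric.isOpen_iff.1 hU y y.2
    obtain ⟨r, hr0, -, hr⟩ := exists_rpow_radius hA hα hε
    refine ⟨r, hr0, fun w hw => hεU ?_⟩
    rw [Metric.mem_ball, dist_comm]
    refine (hcomp _ _).1.trans_lt (lt_of_lt_of_le ?_ hr)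
    exact mul_lt_mul_of_pos_left (Real.rpow_lt_rpow (hX.quasi.1 _ _) hw hα) (by linarith)
  choose r hr0 hrU using hex
  have hsub : ∀ y : U, Metric.ball (y : Ω) (r y ^ α / A) ⊆ {w : Ω | ρ (y : Ω) w < r y} := by
    intro y w hw
    rw [Metric.mem_ball, dist_comm, lt_div_iff₀' (by linarith)] at hw
    exact (Real.rpow_lt_rpow_iff (hX.quasi.1 _ _) (hr0 y).le hα).1 ((hcomp _ _).2.trans_lt hw)
  obtain ⟨T, hT, hTU⟩ := TopologicalSpace.isOpen_iUnion_countable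
    (fun y : U => Metric.ball (y : Ω) (r y ^ α / A)) fun _ => Metric.isOpen_ball
  have hUeq : U = ⋃ y ∈ T, {w : Ω | ρ (y : Ω) w < r y} := by
    refine Subset.antisymm (fun w hw => ?_) (iUnion₂_subset fun y _ => hrU y)
    have hw' : w ∈ ⋃ y : U, Metric.ball (y : Ω) (r y ^ α / A) :=
      mem_iUnion.2 ⟨⟨w, hw⟩, Metric.mem_ball_self
        (div_pos (Real.rpow_pos_of_pos (hr0 _) _) (by linarith))⟩
    rw [← hTU] at hw'
    exact iUnion₂_mono (fun y _ => hsub y) hw'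
  rw [hUeq]
  exact MeasurableSet.biUnion hT fun y _ => hball y _ (hr0 y)

end Measurability

/-- A self-improvement argument: a positive monotone function on `(0, 1]` whose values at two
points control their distance cannot be too small at `1`. -/
theorem exists_lower_bound_of_rpow_gap {K a σ θ : ℝ} (hK : 0 < K) (hσ : 0 < σ) (hσa : σ < a)
    (hθ : 0 < θ) :
    ∃ C : ℝ, 0 < C ∧ ∀ h : ℝ → ℝ, (∀ x, 0 < x → 0 < h x) → Monotone h →
      (∀ x' x, 0 < x' → x' < x → x ≤ 1 → h x' ^ (a - σ) * (x - x') ^ θ ≤ K * h x ^ a) →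
      1 ≤ C * h 1 := by
  set β := σ / θ with hβ
  have hβ0 : 0 < β := by positivity
  set K₁ := (K * 2 ^ (a - σ)) ^ θ⁻¹ with hK₁
  have hK₁0 : 0 < K₁ := by positivity
  have h2β : (2 : ℝ) ^ (-β) < 1 := Real.rpow_lt_one_of_one_lt_of_neg one_lt_two (by linarith)
  set D := 2 * K₁ / (1 - 2 ^ (-β)) with hD
  have hD0 : 0 < D := div_pos (by positivity) (by linarith)
  have hDK : D * 2 ^ (-β) = D - 2 * K₁ := by
    have : D * (1 - 2 ^ (-β)) = 2 * K₁ := div_mul_cancel₀ _ (by linarith)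
    linarith
  refine ⟨D ^ β⁻¹, by positivity, fun h hpos hmono hgap => ?_⟩
  have hhalf : ∀ x' x, 0 < x' → x' < x → x ≤ 1 → 2 * K₁ * h x ^ β ≤ x - x' →
      h x' ≤ h x / 2 := by
    intro x' x hx' hxx hx1 hdist
    by_contra! hlt
    have hx := hpos x (hx'.trans hxx)
    have h1 : (h x / 2) ^ (a - σ) * (x - x') ^ θ ≤ K * h x ^ a :=
      (mul_le_mul_of_nonneg_right (Real.rpow_le_rpow (by positivity) hlt.le (by linarith))
        (Real.rpow_nonneg (by linarith) _)).trans (hgap x' x hx' hxx hx1)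
    have h2 : (x - x') ^ θ ≤ K * 2 ^ (a - σ) * h x ^ σ := by
      have h3 : 0 < (h x / 2) ^ (a - σ) := by positivity
      refine le_of_mul_le_mul_left (h1.trans_eq ?_) h3
      rw [Real.div_rpow hx.le zero_le_two, ← sub_add_cancel a σ, Real.rpow_add hx]
      simp only [add_sub_cancel_right]
      field_simp
    have h4 : x - x' ≤ K₁ * h x ^ β := by
      calc x - x' = ((x - x') ^ θ) ^ θ⁻¹ := (Real.rpow_rpow_inv (by linarith) hθ.ne').symm
        _ ≤ (K * 2 ^ (a - σ) * h x ^ σ) ^ θ⁻¹ :=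
          Real.rpow_le_rpow (Real.rpow_nonneg (by linarith) _) h2 (by positivity)
        _ = K₁ * h x ^ β := by
          rw [Real.mul_rpow (by positivity) (by positivity), ← Real.rpow_mul hx.le, hβ,
            div_eq_mul_inv]
    have : 0 < K₁ * h x ^ β := by positivity
    linarith
  have h1 := hpos 1 one_pos
  suffices hmain : 1 ≤ D * h 1 ^ β by
    calc (1 : ℝ) ≤ (D * h 1 ^ β) ^ β⁻¹ := Real.one_le_rpow hmain (by positivity)
      _ = D ^ β⁻¹ * h 1 := by
        rw [Real.mul_rpow hD0.le (by positivity), Real.rpow_rpow_inv h1.le hβ0.ne']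
  by_contra! hlt
  set c := 1 - D * h 1 ^ β with hc
  have hc0 : 0 < c := by linarith
  have hiter : ∀ n : ℕ, ∃ x, c ≤ x ∧ x ≤ 1 ∧ c + D * h x ^ β ≤ x ∧ h x ≤ h 1 / 2 ^ n := by
    intro n
    induction n with
    | zero =>
      have : 0 < D * h 1 ^ β := by positivity
      exact ⟨1, by linarith, le_rfl, by linarith, by simp⟩
    | succ n ih =>
      obtain ⟨x, hcx, hx1, hDx, hhx⟩ := ih
      have hx := hpos x (hc0.trans_le hcx)
      have hstep : 0 < 2 * K₁ * h x ^ β := by positivity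
      have hrem : c + D * 2 ^ (-β) * h x ^ β ≤ x - 2 * K₁ * h x ^ β := by
        rw [hDK]
        linarith
      have hrem0 : 0 < D * 2 ^ (-β) * h x ^ β := by positivity
      have hh := hhalf (x - 2 * K₁ * h x ^ β) x (by linarith) (by linarith) hx1 (by linarith)
      refine ⟨x - 2 * K₁ * h x ^ β, by linarith, by linarith, le_trans ?_ hrem, ?_⟩
      · have h5 : h (x - 2 * K₁ * h x ^ β) ^ β ≤ 2 ^ (-β) * h x ^ β := by
          calc _ ≤ (h x / 2) ^ β := Real.rpow_le_rpow (hpos _ (by linarith)).le hh hβ0.le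
            _ = _ := by
              rw [Real.div_rpow hx.le zero_le_two, Real.rpow_neg zero_le_two]
              ring
        nlinarith
      · rw [pow_succ, ← div_div]
        linarith
  obtain ⟨n, hn⟩ := pow_unbounded_of_one_lt (h 1 / h c) one_lt_two
  obtain ⟨x, hcx, -, -, hhx⟩ := hiter n
  have h6 := hmono hcx
  rw [div_lt_iff₀ (hpos c hc0)] at hn
  rw [le_div_iff₀ (by positivity)] at hhx
  have h7 : (0 : ℝ) < 2 ^ n := by positivity
  nlinarith

section SequenceNorm

variable {q : ℝ≥0∞}

theorem lqN_mono {a b : ℤ → ℝ≥0∞} (h : ∀ k, a k ≤ b k) : lqN q a ≤ lqN q b := by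
  unfold lqN
  split_ifs
  · exact iSup_mono h
  · refine ENNReal.rpow_le_rpow (ENNReal.tsum_le_tsum fun k => ?_) (by positivity)
    exact ENNReal.rpow_le_rpow (h k) ENNReal.toReal_nonneg

theorem lqN_const_mul (hq : 0 < q) (c : ℝ≥0∞) (a : ℤ → ℝ≥0∞) :
    lqN q (fun k => c * a k) = c * lqN q a := by
  unfold lqN
  split_ifs with hq'
  · rw [ENNReal.mul_iSup]
  · have hq0 : 0 < q.toReal := ENNReal.toReal_pos hq.ne' hq'
    simp_rw [ENNReal.mul_rpow_of_nonneg _ _ hq0.le]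
    rw [ENNReal.tsum_mul_left, ENNReal.mul_rpow_of_nonneg _ _ (by positivity), one_div,
      ENNReal.rpow_rpow_inv hq0.ne']

theorem lqN_zero (hq : 0 < q) : lqN q (fun _ => 0) = 0 := by
  simpa using lqN_const_mul hq 0 fun _ => 0

theorem lqN_comp_add_left (k₀ : ℤ) (a : ℤ → ℝ≥0∞) : lqN q (fun k => a (k₀ + k)) = lqN q a := by
  unfold lqN
  split_ifs
  · exact (Equiv.addLeft k₀).iSup_comp (g := a)
  · rw [← (Equiv.addLeft k₀).tsum_eq fun k => a k ^ q.toReal]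
    rfl

theorem lqN_two_rpow_ne_top (hq : 0 < q) {δ : ℝ} (hδ : 0 ≤ δ) (hδq : q ≠ ∞ → 0 < δ) :
    lqN q (fun k => ENNReal.ofReal (2 ^ (-(δ * |(k : ℝ)|)))) ≠ ∞ := by
  unfold lqN
  split_ifs with hq'
  · refine ne_top_of_le_ne_top ENNReal.one_ne_top (iSup_le fun k => ?_)
    rw [ENNReal.ofReal_le_one]
    exact Real.rpow_le_one_of_one_le_of_nonpos one_le_two (neg_nonpos.2 (by positivity))
  · have hq0 : 0 < q.toReal := ENNReal.toReal_pos hq.ne' hq'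
    refine ENNReal.rpow_ne_top_of_nonneg (by positivity) ?_
    simp_rw [ENNReal.ofReal_rpow_of_nonneg (Real.rpow_nonneg zero_le_two _) hq0.le]
    refine Summable.tsum_ofReal_ne_top ?_
    have hgeom : Summable fun n : ℕ => ((2 : ℝ) ^ (-(δ * q.toReal))) ^ n :=
      summable_geometric_of_lt_one (by positivity)
        (Real.rpow_lt_one_of_one_lt_of_neg one_lt_two (by have := hδq hq'; nlinarith))
    refine Summable.of_nat_of_neg (hgeom.congr fun n => ?_) (hgeom.congr fun n => ?_) <;>
    · rw [← Real.rpow_natCast, ← Real.rpow_mul zero_le_two, ← Real.rpow_mul zero_le_two]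
      congr 1
      simp
      ring

end SequenceNorm

/-- The constant value, at the scale `2 ^ (-k)`, of the canonical fractional `s`-gradient of a
function whose oscillation at distance `t` is at most `min (L * t ^ α) 1`. -/
def gradProfile (s α L : ℝ) (k : ℤ) : ℝ :=
  min (L * 2 ^ (-(k * (α - s)))) (2 ^ ((k + 1) * s))

theorem gradProfile_nonneg {s α L : ℝ} (hL : 0 < L) (k : ℤ) : 0 ≤ gradProfile s α L k := by
  unfold gradProfile
  positivity

theorem exists_lqN_gradProfile_le {q : ℝ≥0∞} (hq : 0 < q) {s α : ℝ} (hs : 0 < s) (hsα : s ≤ α)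
    (hsq : q ≠ ∞ → s < α) :
    ∃ C : ℝ, 0 < C ∧ ∀ L : ℝ, 0 < L →
      lqN q (fun k => ENNReal.ofReal (gradProfile s α L k)) ≤
        ENNReal.ofReal (C * L ^ (s / α)) := by
  have hα : 0 < α := hs.trans_le hsα
  set δ := min (α - s) s
  have hδα : δ ≤ α - s := min_le_left _ _
  have hδs : δ ≤ s := min_le_right _ _
  have hfin := lqN_two_rpow_ne_top hq (le_min (sub_nonneg.2 hsα) hs.le)
    fun h => lt_min (sub_pos.2 (hsq h)) hs
  set N := lqN q fun k => ENNReal.ofReal (2 ^ (-(δ * |(k : ℝ)|))) with hN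
  refine ⟨2 ^ (2 * s) * (N.toReal + 1), by positivity, fun L hL => ?_⟩
  set κ := Real.logb 2 L / α with hκ
  have hLκ : L = 2 ^ (α * κ) := by
    rw [hκ, mul_div_cancel₀ _ hα.ne', Real.rpow_logb two_pos (by norm_num) hL]
  have hLs : L ^ (s / α) = 2 ^ (s * κ) := by
    rw [hLκ, ← Real.rpow_mul zero_le_two]
    congr 1
    field_simp
  have hk1 : κ ≤ ⌈κ⌉ := Int.le_ceil κ
  have hk2 : (⌈κ⌉ : ℝ) < κ + 1 := Int.ceil_lt_add_one κ
  have hpt : ∀ j : ℤ, gradProfile s α L (⌈κ⌉ + j) ≤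
      2 ^ (2 * s) * L ^ (s / α) * 2 ^ (-(δ * |(j : ℝ)|)) := by
    intro j
    rw [hLs, ← Real.rpow_add two_pos, ← Real.rpow_add two_pos]
    unfold gradProfile
    push_cast
    rcases le_total 0 (j : ℝ) with hj | hj
    · refine (min_le_left _ _).trans ?_
      rw [hLκ, ← Real.rpow_add two_pos, abs_of_nonneg hj]
      refine Real.rpow_le_rpow_of_exponent_le one_le_two ?_
      nlinarith
    · refine (min_le_right _ _).trans ?_
      rw [abs_of_nonpos hj]
      refine Real.rpow_le_rpow_of_exponent_le one_le_two ?_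
      nlinarith
  calc lqN q (fun k => ENNReal.ofReal (gradProfile s α L k))
      = lqN q (fun j => ENNReal.ofReal (gradProfile s α L (⌈κ⌉ + j))) :=
        (lqN_comp_add_left ⌈κ⌉ fun k => ENNReal.ofReal (gradProfile s α L k)).symm
    _ ≤ lqN q (fun j => ENNReal.ofReal (2 ^ (2 * s) * L ^ (s / α)) *
          ENNReal.ofReal (2 ^ (-(δ * |(j : ℝ)|)))) := by
        refine lqN_mono fun j => ?_
        rw [← ENNReal.ofReal_mul (by positivity)]
        exact ENNReal.ofReal_le_ofReal (hpt j)
    _ = ENNReal.ofReal (2 ^ (2 * s) * L ^ (s / α)) * N := lqN_const_mul hq _ _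
    _ ≤ ENNReal.ofReal (2 ^ (2 * s) * L ^ (s / α)) * ENNReal.ofReal (N.toReal + 1) := by
        gcongr
        exact (ENNReal.ofReal_toReal hfin).symm.le.trans (ENNReal.ofReal_le_ofReal (by linarith))
    _ = _ := by
        rw [← ENNReal.ofReal_mul (by positivity)]
        congr 1
        ring

section Bump

variable {ρ : X → X → ℝ} {μ : Measure X} {Ω V : Set X} {s α L p : ℝ} {q : ℝ≥0∞} {u : X → ℝ}

theorem lpN_const_indicator (hp : 0 < p) (hV : MeasurableSet V) (ν : Measure X) (c : ℝ≥0∞) :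
    lpN ν p (V.indicator fun _ => c) = c * ν V ^ (1 / p) := by
  have : ∀ x, V.indicator (fun _ => c) x ^ p = V.indicator (fun _ => c ^ p) x := fun x => by
    by_cases hx : x ∈ V <;> simp [hx, hp]
  simp_rw [lpN, this]
  rw [lintegral_indicator_const hV, ENNReal.mul_rpow_of_nonneg _ _ (by positivity), one_div,
    ENNReal.rpow_rpow_inv hp.ne']

theorem gradProfile_indicator_mem_fracGrad (hs : 0 < s) (hsα : s ≤ α) (hL : 0 < L)
    (hV : MeasurableSet V) (hu : ∀ y ∈ Ω, y ∉ V → u y = 0)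
    (hu₁ : ∀ y ∈ Ω, ∀ z ∈ Ω, |u y - u z| ≤ 1)
    (huL : ∀ y ∈ Ω, ∀ z ∈ Ω, |u y - u z| ≤ L * ρ y z ^ α) :
    (fun k => V.indicator fun _ => gradProfile s α L k) ∈ fracGrad ρ μ Ω s u := by
  have hnn : ∀ k x, 0 ≤ V.indicator (fun _ => gradProfile s α L k) x := fun k =>
    indicator_nonneg fun _ _ => gradProfile_nonneg hL k
  refine ⟨hnn, fun k => (measurable_const.indicator hV).aemeasurable, ∅, measure_empty, ?_⟩
  rintro k y ⟨hy, -⟩ z ⟨hz, -⟩ hlo hhi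
  have hlo' : (2 : ℝ) ^ (-(k : ℝ) - 1) ≤ ρ y z := by
    rw [← Real.rpow_intCast] at hlo
    exact_mod_cast hlo
  have hhi' : ρ y z < (2 : ℝ) ^ (-(k : ℝ)) := by
    rw [← Real.rpow_intCast] at hhi
    exact_mod_cast hhi
  have hρ : 0 < ρ y z := (by positivity : (0 : ℝ) < 2 ^ (-(k : ℝ) - 1)).trans_le hlo'
  have hρs : 0 < ρ y z ^ s := by positivity
  by_cases hyz : y ∈ V ∨ z ∈ V
  · have hsum : gradProfile s α L k ≤ V.indicator (fun _ => gradProfile s α L k) y +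
        V.indicator (fun _ => gradProfile s α L k) z := by
      rcases hyz with h | h
      · simpa [h] using hnn k z
      · simpa [h] using hnn k y
    refine le_trans ?_ (mul_le_mul_of_nonneg_left hsum hρs.le)
    unfold gradProfile
    rw [mul_min_of_nonneg _ _ hρs.le]
    refine le_min ((huL y hy z hz).trans ?_) ((hu₁ y hy z hz).trans ?_)
    · have h1 : ρ y z ^ (α - s) ≤ 2 ^ (-(k * (α - s))) := by
        calc ρ y z ^ (α - s) ≤ ((2 : ℝ) ^ (-(k : ℝ))) ^ (α - s) :=
              Real.rpow_le_rpow hρ.le hhi'.le (by linarith)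
          _ = _ := by rw [← Real.rpow_mul zero_le_two, neg_mul]
      calc L * ρ y z ^ α = ρ y z ^ s * (L * ρ y z ^ (α - s)) := by
            rw [mul_left_comm, ← Real.rpow_add hρ, add_sub_cancel]
        _ ≤ _ := by gcongr
    · calc (1 : ℝ) = ((2 : ℝ) ^ (-(k : ℝ) - 1)) ^ s * 2 ^ ((k + 1) * s) := by
            rw [← Real.rpow_mul zero_le_two, ← Real.rpow_add two_pos,
              show (-(k : ℝ) - 1) * s + (k + 1) * s = 0 by ring, Real.rpow_zero]
        _ ≤ _ := by gcongr
  · push Not at hyz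
    simp [hu y hy hyz.1, hu z hz hyz.2, hyz.1, hyz.2]

theorem MdotNorm_le_of_bump (hp : 0 < p) (hq : 0 < q) (hs : 0 < s) (hsα : s ≤ α) (hL : 0 < L)
    (hV : MeasurableSet V) (hu : ∀ y ∈ Ω, y ∉ V → u y = 0)
    (hu₁ : ∀ y ∈ Ω, ∀ z ∈ Ω, |u y - u z| ≤ 1)
    (huL : ∀ y ∈ Ω, ∀ z ∈ Ω, |u y - u z| ≤ L * ρ y z ^ α) :
    MdotNorm ρ μ Ω s p q u ≤
      lqN q (fun k => ENNReal.ofReal (gradProfile s α L k)) * μ V ^ (1 / p) := by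
  refine (iInf₂_le _ (gradProfile_indicator_mem_fracGrad hs hsα hL hV hu hu₁ huL)).trans ?_
  have : (fun x => lqN q fun k => ENNReal.ofReal (V.indicator (fun _ => gradProfile s α L k) x)) =
      V.indicator fun _ => lqN q fun k => ENNReal.ofReal (gradProfile s α L k) := by
    funext x
    by_cases hx : x ∈ V <;> simp [hx, lqN_zero hq]
  rw [this, lpN_const_indicator hp hV]
  gcongr
  exact Measure.restrict_le_self

end Bump

section Embedding

variable {ρ : X → X → ℝ} {μ : Measure X} {Ω : Set X} [PseudoMetricSpace Ω] {A α : ℝ}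

omit [MeasurableSpace X] in
theorem coe_image_ball_subset_qball (hρ : ∀ y z, 0 ≤ ρ y z) (hA : 1 ≤ A) (hα : 0 < α)
    (hle : ∀ y z : Ω, ρ y z ^ α ≤ A * dist y z) (x : Ω) {t r : ℝ} (hr : 0 < r)
    (htr : A * t ≤ r ^ α) :
    Subtype.val '' Metric.ball x t ⊆ qball ρ x r := by
  rintro _ ⟨y, hy, rfl⟩
  rw [Metric.mem_ball, dist_comm] at hy
  refine (Real.rpow_lt_rpow_iff (hρ _ _) hr.le hα).1 (lt_of_lt_of_le ?_ htr)
  exact (hle x y).trans_lt (mul_lt_mul_of_pos_left hy (by linarith))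

theorem measure_coe_image_ball_lt_top (hX : IsQMMS ρ μ) (hA : 1 ≤ A) (hα : 0 < α)
    (hle : ∀ y z : Ω, ρ y z ^ α ≤ A * dist y z) (x : Ω) (t : ℝ) :
    μ (Subtype.val '' Metric.ball x t) < ∞ := by
  have hpos : 0 < A * max t 1 := mul_pos (by linarith) (lt_max_of_lt_right one_pos)
  refine (measure_mono (coe_image_ball_subset_qball hX.quasi.1 hA hα hle x
    (r := (A * max t 1) ^ α⁻¹) (by positivity) ?_)).trans_lt
    (hX.ball_lt_top _ _ (by positivity))
  rw [Real.rpow_inv_rpow hpos.le hα.ne']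
  exact mul_le_mul_of_nonneg_left (le_max_left _ _) (by linarith)

theorem measure_coe_image_ball_pos (hρ : ∀ y z, 0 ≤ ρ y z)
    (hΩpos : ∀ x ∈ Ω, ∀ r : ℝ, 0 < r → r ≤ 1 → 0 < μ (qball ρ x r ∩ Ω)) (hA : 1 ≤ A)
    (hα : 0 < α) (hle : ∀ y z : Ω, dist y z ≤ A * ρ y z ^ α) (x : Ω) {t : ℝ} (ht : 0 < t) :
    0 < μ (Subtype.val '' Metric.ball x t) := by
  obtain ⟨r, hr0, hr1, hr⟩ := exists_rpow_radius hA hα ht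
  refine (hΩpos x x.2 r hr0 hr1).trans_le (measure_mono ?_)
  rintro y ⟨hy, hyΩ⟩
  refine ⟨⟨y, hyΩ⟩, ?_, rfl⟩
  rw [Metric.mem_ball, dist_comm]
  refine (hle x ⟨y, hyΩ⟩).trans_lt (lt_of_lt_of_le ?_ hr)
  exact mul_lt_mul_of_pos_left (Real.rpow_lt_rpow (hρ _ _) hy hα) (by linarith)

/-- The Lipschitz cutoff equal to `1` for `dist y x ≤ t'` and to `0` for `t ≤ dist y x`,
extended by `0` outside `Ω`. -/
def cutoff (x : Ω) (t' t : ℝ) : X → ℝ :=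
  Function.extend Subtype.val (fun y : Ω => max 0 (min 1 ((t - dist y x) / (t - t')))) 0

omit [MeasurableSpace X] in
theorem cutoff_coe (x : Ω) (t' t : ℝ) (y : Ω) :
    cutoff x t' t y = max 0 (min 1 ((t - dist y x) / (t - t'))) :=
  Subtype.val_injective.extend_apply _ _ _

theorem measurable_cutoff [OpensMeasurableSpace Ω] (hΩ : MeasurableSet Ω) (x : Ω) (t' t : ℝ) :
    Measurable (cutoff x t' t) := by
  refine (MeasurableEmbedding.subtype_coe hΩ).measurable_extend ?_ measurable_const
  exact (by fun_prop : Continuous fun y : Ω =>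
    max 0 (min 1 ((t - dist y x) / (t - t')))).measurable

omit [MeasurableSpace X] in
theorem cutoff_nonneg (x : Ω) (t' t : ℝ) (y : Ω) : 0 ≤ cutoff x t' t y := by
  rw [cutoff_coe]
  exact le_max_left _ _

omit [MeasurableSpace X] in
theorem cutoff_le_one (x : Ω) (t' t : ℝ) (y : Ω) : cutoff x t' t y ≤ 1 := by
  rw [cutoff_coe]
  exact max_le zero_le_one (min_le_left _ _)

omit [MeasurableSpace X] in
theorem cutoff_eq_zero {x : Ω} {t' t : ℝ} (htt : t' < t) {y : Ω} (hy : y ∉ Metric.ball x t) :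
    cutoff x t' t y = 0 := by
  rw [Metric.mem_ball, not_lt] at hy
  rw [cutoff_coe]
  exact max_eq_left ((min_le_right _ _).trans
    (div_nonpos_of_nonpos_of_nonneg (by linarith) (by linarith)))

omit [MeasurableSpace X] in
theorem cutoff_eq_one {x : Ω} {t' t : ℝ} (htt : t' < t) {y : Ω} (hy : y ∈ Metric.ball x t') :
    cutoff x t' t y = 1 := by
  rw [Metric.mem_ball] at hy
  rw [cutoff_coe, min_eq_left ((one_le_div (by linarith)).2 (by linarith)),
    max_eq_right zero_le_one]

omit [MeasurableSpace X] in
theorem abs_cutoff_sub_le {t' t : ℝ} (htt : t' < t) (x y z : Ω) :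
    |cutoff x t' t y - cutoff x t' t z| ≤ dist y z / (t - t') := by
  rw [cutoff_coe, cutoff_coe, max_comm 0, max_comm 0, min_comm 1, min_comm 1]
  refine (abs_max_sub_max_le_abs _ _ _).trans ((abs_min_sub_min_le_max _ _ _ _).trans ?_)
  have htt' : 0 < t - t' := by linarith
  rw [sub_self, abs_zero, max_eq_left (abs_nonneg _), ← sub_div, abs_div, abs_of_pos htt']
  gcongr
  rw [show t - dist y x - (t - dist z x) = -(dist y x - dist z x) by ring, abs_neg]
  exact abs_dist_sub_le y z x

/-- Testing the embedding on a cutoff compares the measures of two concentric balls. -/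
theorem measure_ball_rpow_le_of_embedding (hρ : ∀ y z, 0 ≤ ρ y z) (hΩ : MeasurableSet Ω)
    [OpensMeasurableSpace Ω] (hA : 1 ≤ A) (hα : 0 < α)
    (hcomp : ∀ y z : Ω, dist y z ≤ A * ρ y z ^ α ∧ ρ y z ^ α ≤ A * dist y z)
    {s p p' r : ℝ} {q G : ℝ≥0∞} (hs : 0 < s) (hsα : s ≤ α) (hp : 0 < p) (hp' : 0 < p')
    (hq : 0 < q) (hr : 0 < r) {x : Ω} {t' t : ℝ} (htt : t' < t) (htr : A * t ≤ r ^ α)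
    (hfin : μ (Subtype.val '' Metric.ball x t) < ∞) {N : ℝ≥0∞}
    (hN : lqN q (fun k => ENNReal.ofReal (gradProfile s α (A / (t - t')) k)) ≤ N) (hNtop : N ≠ ∞)
    {F : ℝ≥0∞}
    (hemb : ∀ u : X → ℝ, AEMeasurable u (μ.restrict Ω) → MdotNorm ρ μ Ω s p q u ≠ ∞ →
      lpOn μ (qball ρ x r ∩ Ω) p' u ≤ F * (G * MdotNorm ρ μ Ω s p q u + lpOn μ Ω p u)) :
    μ (Subtype.val '' Metric.ball x t') ^ (1 / p') ≤
      F * ((G * N + 1) * μ (Subtype.val '' Metric.ball x t) ^ (1 / p)) := by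
  have htt' : 0 < t - t' := by linarith
  set V : ℝ → Set X := fun τ => Subtype.val '' Metric.ball x τ with hVdef
  have hV : ∀ τ, MeasurableSet (V τ) := fun τ =>
    hΩ.subtype_image Metric.isOpen_ball.measurableSet
  have hVΩ : ∀ τ, V τ ⊆ Ω := fun τ => by
    rintro _ ⟨y, -, rfl⟩
    exact y.2
  set u := cutoff x t' t with hu
  have hu0 : ∀ y ∈ Ω, y ∉ V t → u y = 0 := fun y hy hyV =>
    cutoff_eq_zero htt (y := ⟨y, hy⟩) fun h => hyV ⟨_, h, rfl⟩
  have hM : MdotNorm ρ μ Ω s p q u ≤ N * μ (V t) ^ (1 / p) := by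
    refine (MdotNorm_le_of_bump hp hq hs hsα (div_pos (by linarith) htt') (hV t) hu0
      (fun y hy z hz => ?_) fun y hy z hz => ?_).trans (mul_le_mul_left hN _)
    · rw [abs_le]
      constructor <;>
      linarith [cutoff_nonneg x t' t ⟨y, hy⟩, cutoff_le_one x t' t ⟨y, hy⟩,
        cutoff_nonneg x t' t ⟨z, hz⟩, cutoff_le_one x t' t ⟨z, hz⟩]
    · refine (abs_cutoff_sub_le htt x ⟨y, hy⟩ ⟨z, hz⟩).trans ?_
      rw [div_mul_eq_mul_div]
      gcongr
      exact (hcomp ⟨y, hy⟩ ⟨z, hz⟩).1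
  have hMfin : MdotNorm ρ μ Ω s p q u ≠ ∞ :=
    ne_top_of_le_ne_top (ENNReal.mul_ne_top hNtop
      (ENNReal.rpow_ne_top_of_nonneg (by positivity) hfin.ne)) hM
  have hL : lpOn μ Ω p u ≤ μ (V t) ^ (1 / p) := by
    calc lpOn μ Ω p u ≤ lpN (μ.restrict Ω) p ((V t).indicator fun _ => 1) := by
          unfold lpOn lpN
          refine ENNReal.rpow_le_rpow (setLIntegral_mono' hΩ fun y hy => ?_) (by positivity)
          refine ENNReal.rpow_le_rpow ?_ hp.le
          by_cases hyV : y ∈ V t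
          · rw [indicator_of_mem hyV, ENNReal.ofReal_le_one,
              abs_of_nonneg (cutoff_nonneg x t' t ⟨y, hy⟩)]
            exact cutoff_le_one x t' t ⟨y, hy⟩
          · simp [hu0 y hy hyV]
      _ = μ (V t) ^ (1 / p) := by
          rw [lpN_const_indicator hp (hV t), one_mul, Measure.restrict_eq_self _ (hVΩ t)]
  have hlow : μ (V t') ^ (1 / p') ≤ lpOn μ (qball ρ x r ∩ Ω) p' u := by
    have hsub : V t' ⊆ qball ρ x r ∩ Ω := fun y hy =>
      ⟨coe_image_ball_subset_qball hρ hA hα (fun y z => (hcomp y z).2) x hr htr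
        (image_mono (Metric.ball_subset_ball htt.le) hy), hVΩ _ hy⟩
    calc μ (V t') ^ (1 / p')
        = lpN (μ.restrict (qball ρ x r ∩ Ω)) p' ((V t').indicator fun _ => 1) := by
          rw [lpN_const_indicator hp' (hV t'), one_mul, Measure.restrict_eq_self _ hsub]
      _ ≤ _ := by
          unfold lpOn lpN
          refine ENNReal.rpow_le_rpow (lintegral_mono fun y => ?_) (by positivity)
          refine ENNReal.rpow_le_rpow ?_ hp'.le
          refine indicator_apply_le' (fun hy => ?_) fun _ => zero_le
          obtain ⟨z, hz, rfl⟩ := hy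
          simp [hu, cutoff_eq_one htt hz]
  calc μ (V t') ^ (1 / p') ≤ _ := hlow
    _ ≤ F * (G * MdotNorm ρ μ Ω s p q u + lpOn μ Ω p u) :=
      hemb u (measurable_cutoff hΩ x t' t).aemeasurable hMfin
    _ ≤ F * (G * (N * μ (V t) ^ (1 / p)) + μ (V t) ^ (1 / p)) := by gcongr
    _ = _ := by ring

end Embedding

/-- Theorem 4.4 ((d) ⟹ (a)): a local Sobolev-type embedding for `Ṁ^s_{p,q}(Ω)` with
`s ⪯_q ind(Ω,ρ)` and `p ∈ (0,Q/s)` forces the measure density condition. -/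
theorem M_embedding_implies_measure_density
    {X : Type*} [MeasurableSpace X] (ρ : X → X → ℝ) (μ : Measure X)
    (hX : IsQMMS ρ μ) (hreg : BorelRegular μ)
    (Q : ℝ) (hQ : 0 < Q) (hdoub : QDoubling ρ μ Q)
    (Ω : Set X) (hΩmeas : MeasurableSet Ω)
    (hΩpos : ∀ x ∈ Ω, ∀ r : ℝ, 0 < r → r ≤ 1 → 0 < μ (qball ρ x r ∩ Ω))
    (hperf : ∃ lam : ℝ, 0 < lam ∧ lam < 1 ∧ LocUnifPerfect ρ Ω lam)
    (s p : ℝ) (q : ℝ≥0∞) (hs : 0 < s) (hp : 0 < p) (hpQ : p < Q / s) (hq : 0 < q)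
    (hind : SPrecIndex (fun a b : Ω => ρ a.1 b.1) s q)
    (CS : ℝ) (hCS : 0 < CS)
    (hemb : ∀ x₀ ∈ Ω, ∀ R₀ : ℝ, 0 < R₀ → R₀ ≤ 1 →
      ∀ u : X → ℝ, AEMeasurable u (μ.restrict Ω) → MdotNorm ρ μ Ω s p q u ≠ ∞ →
        lpOn μ (qball ρ x₀ R₀ ∩ Ω) (Q * p / (Q - s * p)) u ≤
          (ENNReal.ofReal CS / μ (qball ρ x₀ R₀) ^ (s / Q)) *
            (ENNReal.ofReal (R₀ ^ s) * MdotNorm ρ μ Ω s p q u + lpOn μ Ω p u)) :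
    MeasDensity ρ μ Ω := by
  have hsQ : s * p < Q := by rwa [lt_div_iff₀ hs, mul_comm] at hpQ
  obtain ⟨α, hsα, hsq, m, A, hA, hcomp⟩ := hind.exists_pseudoMetric hs
  have hα : 0 < α := hs.trans_le hsα
  have hρ := hX.quasi.1
  have := opensMeasurable_of_dist_comparable hX hΩmeas hΩpos hA hα hcomp
  obtain ⟨C₃, hC₃, hN⟩ := exists_lqN_gradProfile_le hq hs hsα hsq
  have hA0 : 0 < A := by linarith
  set θ := s / α with hθ
  have hθ0 : 0 < θ := by positivity
  have hσa : s / Q < 1 / p := by rw [div_lt_div_iff₀ hQ hp]; linarith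
  set p' := Q * p / (Q - s * p) with hp'
  have hp'0 : 0 < p' := div_pos (by positivity) (by linarith)
  have hp'inv : 1 / p' = 1 / p - s / Q := by
    have : Q - s * p ≠ 0 := by linarith
    rw [hp']
    field_simp
  obtain ⟨C, hC, hmain⟩ := exists_lower_bound_of_rpow_gap
    (K := CS * ((C₃ + 1) * (A * A) ^ θ)) (by positivity) (by positivity) hσa hθ0
  refine ⟨C, hC, fun x hx r hr hr1 => ?_⟩
  have hBtop := hX.ball_lt_top x r hr
  have hMpos : 0 < (μ (qball ρ x r)).toReal := ENNReal.toReal_pos (hX.ball_pos x r hr).ne' hBtop.ne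
  set M := (μ (qball ρ x r)).toReal with hM
  have hBM : μ (qball ρ x r) = ENNReal.ofReal M := (ENNReal.ofReal_toReal hBtop.ne).symm
  set τ := r ^ α / A with hτ
  have hτ0 : 0 < τ := by positivity
  have hrτ : r ^ s = (A * τ) ^ θ := by
    rw [hτ, mul_div_cancel₀ _ hA0.ne', ← Real.rpow_mul hr.le, hθ, mul_div_cancel₀ _ hα.ne']
  let x₀ : Ω := ⟨x, hx⟩
  let b : ℝ → ℝ := fun t => (μ (Subtype.val '' Metric.ball x₀ t)).toReal
  have hbtop : ∀ t, μ (Subtype.val '' Metric.ball x₀ t) < ∞ :=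
    measure_coe_image_ball_lt_top hX hA hα (fun y z => (hcomp y z).2) x₀
  have hb : ∀ t, μ (Subtype.val '' Metric.ball x₀ t) = ENNReal.ofReal (b t) := fun t =>
    (ENNReal.ofReal_toReal (hbtop t).ne).symm
  have hbpos : ∀ t, 0 < t → 0 < b t := fun t ht => ENNReal.toReal_pos
    (measure_coe_image_ball_pos hρ hΩpos hA hα (fun y z => (hcomp y z).1) x₀ ht).ne' (hbtop t).ne
  have hbmono : Monotone b := fun t₁ t₂ h => ENNReal.toReal_mono (hbtop t₂).ne
    (measure_mono (image_mono (Metric.ball_subset_ball h)))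
  have hkey := hmain (fun y => b (τ * y) / M) (fun y hy => div_pos (hbpos _ (by positivity)) hMpos)
    (fun y₁ y₂ h => div_le_div_of_nonneg_right (hbmono (by gcongr)) hMpos.le) (by
      intro y' y hy' hyy hy1
      have hy0 : 0 < y := hy'.trans hyy
      have hgap : 0 < y - y' := sub_pos.2 hyy
      have hgap' : 0 < τ * y - τ * y' := by nlinarith
      have hb1 := hbpos (τ * y') (by positivity)
      have hb2 := hbpos (τ * y) (by positivity)
      have hest := measure_ball_rpow_le_of_embedding hρ hΩmeas hA hα hcomp hs hsα hp hp'0 hq hr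
        (x := x₀) (t' := τ * y') (t := τ * y) (by linarith)
        (by
          have : A * τ = r ^ α := by rw [hτ]; field_simp
          nlinarith [Real.rpow_pos_of_pos hr α])
        (hbtop _) (hN _ (by positivity)) ENNReal.ofReal_ne_top (hemb x hx r hr hr1)
      rw [hb, hb, hBM, ENNReal.ofReal_rpow_of_pos hb1, ENNReal.ofReal_rpow_of_pos hb2,
        ENNReal.ofReal_rpow_of_pos hMpos, ← ENNReal.ofReal_div_of_pos (by positivity),
        ← ENNReal.ofReal_mul (by positivity), ← ENNReal.ofReal_one,
        ← ENNReal.ofReal_add (by positivity) zero_le_one, ← ENNReal.ofReal_mul (by positivity),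
        ← ENNReal.ofReal_mul (by positivity), ENNReal.ofReal_le_ofReal_iff (by positivity),
        hp'inv] at hest
      have hcoef : r ^ s * (C₃ * (A / (τ * y - τ * y')) ^ θ) + 1 ≤
          (C₃ + 1) * (A * A) ^ θ / (y - y') ^ θ := by
        have h1 : r ^ s * (A / (τ * y - τ * y')) ^ θ = (A * A) ^ θ / (y - y') ^ θ := by
          rw [hrτ, ← Real.mul_rpow (by positivity) (by positivity),
            ← Real.div_rpow (by positivity) hgap.le]
          congr 1
          rw [← mul_sub]
          field_simp
        have h2 : 1 ≤ (A * A) ^ θ / (y - y') ^ θ := by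
          rw [← Real.div_rpow (by positivity) hgap.le]
          refine Real.one_le_rpow ?_ hθ0.le
          rw [one_le_div hgap]
          nlinarith
        calc _ = C₃ * (r ^ s * (A / (τ * y - τ * y')) ^ θ) + 1 := by ring
          _ ≤ C₃ * ((A * A) ^ θ / (y - y') ^ θ) + (A * A) ^ θ / (y - y') ^ θ := by
            rw [h1]
            gcongr
          _ = _ := by ring
      calc (b (τ * y') / M) ^ (1 / p - s / Q) * (y - y') ^ θ
          = b (τ * y') ^ (1 / p - s / Q) / M ^ (1 / p - s / Q) * (y - y') ^ θ := by
            rw [Real.div_rpow hb1.le hMpos.le]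
        _ ≤ CS / M ^ (s / Q) * ((C₃ + 1) * (A * A) ^ θ / (y - y') ^ θ * b (τ * y) ^ (1 / p)) /
              M ^ (1 / p - s / Q) * (y - y') ^ θ := by
            gcongr
            refine hest.trans ?_
            gcongr
        _ = CS * ((C₃ + 1) * (A * A) ^ θ) * (b (τ * y) / M) ^ (1 / p) := by
            have hMa : M ^ (1 / p) = M ^ (1 / p - s / Q) * M ^ (s / Q) := by
              rw [← Real.rpow_add hMpos, sub_add_cancel]
            rw [Real.div_rpow hb2.le hMpos.le, hMa]
            have : (y - y') ^ θ ≠ 0 := by positivity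
            field_simp)
  have hfinal : M ≤ C * b τ := by
    rw [mul_one, mul_div_assoc', one_le_div hMpos] at hkey
    exact hkey
  calc μ (qball ρ x r) = ENNReal.ofReal M := hBM
    _ ≤ ENNReal.ofReal (C * b τ) := ENNReal.ofReal_le_ofReal hfinal
    _ = ENNReal.ofReal C * μ (Subtype.val '' Metric.ball x₀ τ) := by
      rw [ENNReal.ofReal_mul hC.le, hb]
    _ ≤ ENNReal.ofReal C * μ (qball ρ x r ∩ Ω) := by
      gcongr
      refine subset_inter (coe_image_ball_subset_qball hρ hA hα (fun y z => (hcomp y z).2) x₀ hr ?_)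
        (by rintro _ ⟨y, -, rfl⟩; exact y.2)
      rw [hτ, mul_div_cancel₀ _ hA0.ne']

end HajlaszPaper
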